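/- arXiv:2210.10703 — 2 statements merged into one kernel-verified Lean document; each statement's English description precedes it below -/
import Mathlib

section
/- Rank-based sufficient condition for positive abstention (appendix inequality): Assume n⁺ ≥ 2 and n⁻ ≥ 1, and let i be a positive instance (y(i) = 1) such that r'(i)/n ≤ AUC · p⁻ + (n⁺ − t(i))/n. Then the empirical AUC of the reduced sample obtained by removing i is strictly greater than the empirical AUC of the full sample. -/
open Finset

variable {ι : Type*}

/-- The set of positive instances (label 1) in the sample `S`. -/
noncomputable def posSet (S : Finset ι) (y : ι → Bool) : Finset ι :=
  S.filter (fun i => y i = true)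

/-- The set of negative instances (label 0) in the sample `S`. -/
noncomputable def negSet (S : Finset ι) (y : ι → Bool) : Finset ι :=
  S.filter (fun i => y i = false)

/-- The Mann–Whitney count: number of (positive, negative) pairs ranked correctly. -/
noncomputable def mwCount (S : Finset ι) (s : ι → ℝ) (y : ι → Bool) : ℕ :=
  ((S ×ˢ S).filter (fun p => y p.1 = true ∧ y p.2 = false ∧ s p.2 < s p.1)).card

/-- The empirical AUC (Mann–Whitney statistic) of the sample `S`. -/
noncomputable def auc (S : Finset ι) (s : ι → ℝ) (y : ι → Bool) : ℝ :=
  (mwCount S s y : ℝ) / (((posSet S y).card : ℝ) * ((negSet S y).card : ℝ))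

/-- The rank of `i` in non-descending score order: `#{j ∈ S : s j ≤ s i}`. -/
noncomputable def rank' (S : Finset ι) (s : ι → ℝ) (i : ι) : ℕ :=
  (S.filter (fun j => s j ≤ s i)).card

/-- `t(i)`: the number of positive instances with score at least `s i`. -/
noncomputable def tcount (S : Finset ι) (s : ι → ℝ) (y : ι → Bool) (i : ι) : ℕ :=
  (S.filter (fun j => y j = true ∧ s i ≤ s j)).card

/-- Removing a positive instance `i` from the sample removes exactly the pairs formed by `i` and
the negative instances scored below it. -/
theorem mwCount_erase_add [DecidableEq ι] (S : Finset ι) (s : ι → ℝ) (y : ι → Bool)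
    {i : ι} (hi : i ∈ S) (hyi : y i = true) :
    mwCount (S.erase i) s y + (S.filter (fun j => y j = false ∧ s j < s i)).card =
      mwCount S s y := by
  have himg : (S.filter (fun j => y j = false ∧ s j < s i)).card =
      ((S.filter (fun j => y j = false ∧ s j < s i)).image (fun j => (i, j))).card :=
    (card_image_of_injective _ (Prod.mk_right_injective i)).symm
  unfold mwCount
  rw [himg, ← card_union_of_disjoint]
  · congr 1
    ext ⟨a, b⟩
    simp only [mem_union, mem_filter, mem_product, mem_erase, mem_image, Prod.mk.injEq]
    constructor
    · rintro (h | ⟨j, ⟨hj, hyj, hlt⟩, rfl, rfl⟩)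
      · exact ⟨⟨h.1.1.2, h.1.2.2⟩, h.2⟩
      · exact ⟨⟨hi, hj⟩, hyi, hyj, hlt⟩
    · rintro ⟨⟨ha, hb⟩, hya, hyb, hlt⟩
      by_cases hai : a = i
      · subst hai
        exact Or.inr ⟨b, ⟨hb, hyb, hlt⟩, rfl, rfl⟩
      · refine Or.inl ⟨⟨⟨hai, ha⟩, ?_, hb⟩, hya, hyb, hlt⟩
        rintro rfl
        simp [hyi] at hyb
  · rw [disjoint_left]
    rintro ⟨a, b⟩ h h'
    simp only [mem_filter, mem_product, mem_erase, mem_image, Prod.mk.injEq] at h h'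
    obtain ⟨j, -, rfl, -⟩ := h'
    exact h.1.1.1 rfl

theorem card_posSet_erase_add_one [DecidableEq ι] (S : Finset ι) (y : ι → Bool)
    {i : ι} (hi : i ∈ S) (hyi : y i = true) :
    (posSet (S.erase i) y).card + 1 = (posSet S y).card := by
  unfold posSet
  rw [filter_erase]
  exact card_erase_add_one (by simp [hi, hyi])

theorem negSet_erase [DecidableEq ι] (S : Finset ι) (y : ι → Bool)
    {i : ι} (hyi : y i = true) : negSet (S.erase i) y = negSet S y := by
  unfold negSet
  rw [filter_erase]
  exact erase_eq_of_notMem (by simp [hyi])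

/-- The positive instances are covered by those scored at most `s i` and those scored at least
`s i`, with `i` counted twice. -/
theorem card_posSet_add_card_lt_le_rank'_add_tcount [DecidableEq ι]
    (S : Finset ι) (s : ι → ℝ) (y : ι → Bool) {i : ι} (hi : i ∈ S) (hyi : y i = true) :
    (posSet S y).card + 1 + (S.filter (fun j => y j = false ∧ s j < s i)).card ≤
      rank' S s i + tcount S s y i := by
  have hcover : (posSet S y).card + 1 ≤
      (S.filter (fun j => y j = true ∧ s j ≤ s i)).card + tcount S s y i := by
    unfold tcount
    rw [← card_union_add_card_inter]
    refine add_le_add (card_le_card fun j hj => ?_) (card_pos.2 ⟨i, by simp [hi, hyi]⟩)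
    simp only [posSet, mem_filter] at hj
    simp only [mem_union, mem_filter]
    exact (le_total (s j) (s i)).imp (fun h => ⟨hj.1, hj.2, h⟩) (fun h => ⟨hj.1, hj.2, h⟩)
  have hrank : (S.filter (fun j => y j = true ∧ s j ≤ s i)).card +
      (S.filter (fun j => y j = false ∧ s j < s i)).card ≤ rank' S s i := by
    unfold rank'
    rw [← card_union_of_disjoint]
    · refine card_le_card fun j hj => ?_
      simp only [mem_union, mem_filter] at hj ⊢
      rcases hj with h | h
      · exact ⟨h.1, h.2.2⟩
      · exact ⟨h.1, h.2.2.le⟩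
    · rw [disjoint_left]
      intro j h h'
      simp only [mem_filter] at h h'
      simp [h.2.1] at h'
  omega

/-- Rank-based sufficient condition for positive abstention: if `i` is a positive instance
with `r'(i)/n ≤ AUC · p⁻ + (n⁺ − t(i))/n`, removing `i` strictly increases the empirical AUC. -/
theorem rank_sufficient_positive_abstention [DecidableEq ι]
    (S : Finset ι) (s : ι → ℝ) (y : ι → Bool)
    (hs : Set.InjOn s S)
    (hpos : 2 ≤ (posSet S y).card) (hneg : 1 ≤ (negSet S y).card)
    (i : ι) (hi : i ∈ S) (hyi : y i = true)
    (hcond : (rank' S s i : ℝ) / (S.card : ℝ) ≤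
      auc S s y * (((negSet S y).card : ℝ) / (S.card : ℝ)) +
        (((posSet S y).card : ℝ) - (tcount S s y i : ℝ)) / (S.card : ℝ)) :
    auc S s y < auc (S.erase i) s y := by
  have hcount := mwCount_erase_add S s y hi hyi
  have hcard := card_posSet_erase_add_one S y hi hyi
  have hle := card_posSet_add_card_lt_le_rank'_add_tcount S s y hi hyi
  have hn : (0 : ℝ) < S.card := by exact_mod_cast card_pos.2 ⟨i, hi⟩
  unfold auc at hcond ⊢
  rw [negSet_erase S y hyi]
  generalize (S.filter (fun j => y j = false ∧ s j < s i)).card = b at hcount hle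
  rify at hcount hcard hle hpos hneg
  rw [← mul_div_assoc, ← add_div, div_le_div_iff_of_pos_right hn] at hcond
  have hP : (0 : ℝ) < (posSet S y).card := by linarith
  have hP' : (0 : ℝ) < (posSet (S.erase i) y).card := by linarith
  have hN : (0 : ℝ) < (negSet S y).card := by linarith
  rw [← div_div, div_mul_cancel₀ _ hN.ne'] at hcond
  have hb : (b + 1 : ℝ) ≤ mwCount S s y / (posSet S y).card := by linarith
  rw [le_div_iff₀ hP] at hb
  rw [← div_div, ← div_div, div_lt_div_iff_of_pos_right hN, div_lt_div_iff₀ hP hP']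
  rw [← hcount] at hb ⊢
  rw [← hcard] at hb ⊢
  nlinarith
end

section
/- Gini–AUC identity via the CAP curve: Assume n⁺ ≥ 1 and n⁻ ≥ 1. Then Area/(n · n⁺) − 1/2 = (n⁻/(2n)) · (2 · AUC − 1); equivalently, the CAP-based Gini coefficient G := (Area/(n · n⁺) − 1/2) / (n⁻/(2n)) satisfies G = 2 · AUC − 1. -/
open Finset

variable {ι : Type*}

/-- `T(r)`: the number of positive instances among the `r` highest-scoring instances
(scores are pairwise distinct, so this is the number of positives `j` whose
rank-from-the-top `#{k ∈ S : s k ≥ s j}` is at most `r`). -/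
noncomputable def capT (S : Finset ι) (s : ι → ℝ) (y : ι → Bool) (r : ℕ) : ℕ :=
  (S.filter (fun j => y j = true ∧ (S.filter (fun k => s j ≤ s k)).card ≤ r)).card

/-- The absolute area under the CAP polyline: `Σ_{r=1}^{n} (T(r−1) + T(r))/2`. -/
noncomputable def capArea (S : Finset ι) (s : ι → ℝ) (y : ι → Bool) : ℝ :=
  ∑ r ∈ Finset.range S.card, ((capT S s y r : ℝ) + (capT S s y (r + 1) : ℝ)) / 2

/-- Summing the counting function of `k` over thresholds counts, for each point, the thresholds
above it. -/
theorem sum_range_card_filter_le (P : Finset ι) (k : ι → ℕ) (n : ℕ) :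
    ∑ r ∈ range n, (P.filter (fun j => k j ≤ r)).card = ∑ j ∈ P, (n - k j) := by
  refine (sum_card_bipartiteAbove_eq_sum_card_bipartiteBelow
    (s := range n) (t := P) (fun r j => k j ≤ r)).trans (sum_congr rfl fun j _ => ?_)
  have : bipartiteBelow (fun r j => k j ≤ r) (range n) j = Ico (k j) n := by
    ext r
    simp [bipartiteBelow, and_comm]
  rw [this, Nat.card_Ico]

/-- An injective score orders exactly half of the off-diagonal pairs. -/
theorem two_mul_sum_card_filter_lt (P : Finset ι) (s : ι → ℝ) (hs : Set.InjOn s P) :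
    2 * ∑ j ∈ P, (P.filter (fun k => s k < s j)).card + P.card = P.card ^ 2 := by
  classical
  have hswap : ∑ j ∈ P, (P.filter (fun k => s k < s j)).card =
      ∑ j ∈ P, (P.filter (fun k => s j < s k)).card :=
    (sum_card_bipartiteAbove_eq_sum_card_bipartiteBelow
      (s := P) (t := P) (fun j k => s k < s j))
  have hsplit : ∀ j ∈ P, (P.filter (fun k => s k < s j)).card +
      (P.filter (fun k => s j < s k)).card + 1 = P.card := by
    intro j hj
    have hle : P.filter (fun k => ¬ s k < s j) = insert j (P.filter (fun k => s j < s k)) := by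
      ext k
      simp only [mem_filter, mem_insert, not_lt]
      constructor
      · rintro ⟨hk, h⟩
        rcases h.eq_or_lt with h | h
        · exact Or.inl (hs hk hj h.symm)
        · exact Or.inr ⟨hk, h⟩
      · rintro (rfl | ⟨hk, h⟩)
        · exact ⟨hj, le_rfl⟩
        · exact ⟨hk, h.le⟩
    rw [← card_filter_add_card_filter_not (s := P) (fun k => s k < s j), hle,
      card_insert_of_notMem (by simp), add_assoc]
  have hsum := sum_congr rfl hsplit
  simp only [sum_add_distrib, sum_const, smul_eq_mul, mul_one, ← hswap] at hsum
  rw [sq, ← hsum]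
  ring

/-- The Mann–Whitney count, summed over the positive instances. -/
theorem mwCount_eq_sum (S : Finset ι) (s : ι → ℝ) (y : ι → Bool) :
    mwCount S s y =
      ∑ j ∈ posSet S y, ((negSet S y).filter (fun k => s k < s j)).card := by
  have : (S ×ˢ S).filter (fun p => y p.1 = true ∧ y p.2 = false ∧ s p.2 < s p.1) =
      (posSet S y ×ˢ negSet S y).filter (fun p => s p.2 < s p.1) := by
    ext p
    simp only [posSet, negSet, mem_filter, mem_product]
    tauto
  simp only [mwCount, this, card_filter, sum_product]

theorem card_posSet_add_card_negSet (S : Finset ι) (y : ι → Bool) :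
    (posSet S y).card + (negSet S y).card = S.card := by
  have := card_filter_add_card_filter_not (s := S) (fun i => y i = true)
  simpa only [posSet, negSet, Bool.not_eq_true] using this

/-- The area under the CAP polyline in terms of the Mann–Whitney count. -/
theorem capArea_eq (S : Finset ι) (s : ι → ℝ) (y : ι → Bool) (hs : Set.InjOn s S) :
    capArea S s y = mwCount S s y + ((posSet S y).card : ℝ) ^ 2 / 2 := by
  set P := posSet S y with hP
  have hPS : P ⊆ S := filter_subset _ _
  let k : ι → ℕ := fun j => (S.filter (fun i => s j ≤ s i)).card
  have hcap : ∀ r, capT S s y r = (P.filter (fun j => k j ≤ r)).card := by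
    intro r
    rw [hP, posSet, filter_filter]
    rfl
  have hbelow : ∀ j, S.card - k j = (P.filter (fun i => s i < s j)).card +
      ((negSet S y).filter (fun i => s i < s j)).card := by
    intro j
    have h₁ := card_filter_add_card_filter_not (s := S) (fun i => s j ≤ s i)
    have h₂ := card_posSet_add_card_negSet (S.filter (fun i => s i < s j)) y
    simp only [not_le] at h₁
    simp only [posSet, negSet, hP, filter_comm (fun i => s i < s j)] at h₂ ⊢
    simp only [k]
    omega
  have hsum : ∑ r ∈ range S.card, capT S s y r = ∑ j ∈ P, (S.card - k j) := by
    simp only [hcap, sum_range_card_filter_le]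
  have hsum_succ : ∑ r ∈ range S.card, capT S s y (r + 1) =
      ∑ j ∈ P, (S.card - k j) + P.card := by
    simp only [hcap, ← Nat.sub_le_iff_le_add]
    rw [sum_range_card_filter_le P (fun j => k j - 1), card_eq_sum_ones P, ← sum_add_distrib]
    refine sum_congr rfl fun j hj => ?_
    have hpos : 0 < k j := card_pos.mpr ⟨j, mem_filter.mpr ⟨hPS hj, le_rfl⟩⟩
    have hle : k j ≤ S.card := card_filter_le _ _
    omega
  have hpairs := two_mul_sum_card_filter_lt P s (hs.mono (coe_subset.mpr hPS))
  simp only [hbelow, sum_add_distrib, ← mwCount_eq_sum, hP] at hsum hsum_succ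
  rw [capArea, ← sum_div, sum_add_distrib, ← Nat.cast_sum, ← Nat.cast_sum, hsum, hsum_succ,
    ← Nat.cast_pow, ← hpairs]
  push_cast
  ring

/-- Gini–AUC identity via the CAP curve:
`Area/(n · n⁺) − 1/2 = (n⁻/(2n)) · (2 · AUC − 1)`; equivalently, the CAP-based Gini
coefficient `G = (Area/(n · n⁺) − 1/2) / (n⁻/(2n))` satisfies `G = 2 · AUC − 1`. -/
theorem gini_auc_identity (S : Finset ι) (s : ι → ℝ) (y : ι → Bool)
    (hs : Set.InjOn s S)
    (hpos : 1 ≤ (posSet S y).card) (hneg : 1 ≤ (negSet S y).card) :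
    capArea S s y / ((S.card : ℝ) * ((posSet S y).card : ℝ)) - 1 / 2 =
      (((negSet S y).card : ℝ) / (2 * (S.card : ℝ))) * (2 * auc S s y - 1) ∧
    (capArea S s y / ((S.card : ℝ) * ((posSet S y).card : ℝ)) - 1 / 2) /
        (((negSet S y).card : ℝ) / (2 * (S.card : ℝ))) = 2 * auc S s y - 1 := by
  have hp : ((posSet S y).card : ℝ) ≠ 0 := by positivity
  have hn : ((negSet S y).card : ℝ) ≠ 0 := by positivity
  have hcard : (S.card : ℝ) = (posSet S y).card + (negSet S y).card := by
    exact_mod_cast (card_posSet_add_card_negSet S y).symm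
  have hS : (S.card : ℝ) ≠ 0 := by rw [hcard]; positivity
  have key : capArea S s y / ((S.card : ℝ) * ((posSet S y).card : ℝ)) - 1 / 2 =
      (((negSet S y).card : ℝ) / (2 * (S.card : ℝ))) * (2 * auc S s y - 1) := by
    rw [capArea_eq S s y hs, auc]
    field_simp
    rw [hcard]
    ring
  refine ⟨key, ?_⟩
  rw [key]
  exact mul_div_cancel_left₀ _ (div_ne_zero hn (mul_ne_zero two_ne_zero hS))
end
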